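/- Let G be a finite simple graph with a vertex cover S of size k, and let E₁ ⊆ E(G). Let A be a set of vertices of V(G) \ S that all have the same open neighborhood S₁ ⊆ S and for which the set S₂ = {x ∈ S₁ : ux ∈ E₁} is the same for every u ∈ A, and suppose |A| ≥ k(8k² + 8k) + 2. Fix u ∈ A and let H be the graph obtained from G by deleting every edge incident to u that does not belong to E₁ (so E₁ ⊆ E(H)). Then G admits a proper weight function w with w(e) = 1 for all e ∈ E₁ if and only if H admits a proper weight function w with w(e) = 1 for all e ∈ E₁. -/

import Mathlib

variable {V : Type*}

/-- The color of a vertex `v` induced by a `{0,1}`-edge-weighting `w`: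
the sum of the weights of the edges of `G` incident to `v`. -/
noncomputable def vcColor [Finite V] (G : SimpleGraph V) (w : Sym2 V → Fin 2) (v : V) : ℕ :=
  ∑ e ∈ (G.incidenceSet v).toFinite.toFinset, (w e : ℕ)

/-- A weight function is proper if adjacent vertices get distinct colors. -/
def vcProper [Finite V] (G : SimpleGraph V) (w : Sym2 V → Fin 2) : Prop :=
  ∀ u v : V, G.Adj u v → vcColor G w u ≠ vcColor G w v

/-- `S` is a vertex cover of `G`. -/
def IsVertexCover (G : SimpleGraph V) (S : Set V) : Prop :=
  ∀ ⦃u v : V⦄, G.Adj u v → u ∈ S ∨ v ∈ S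

open scoped Classical in
theorem vcColor_eq_sum [Fintype V] (G : SimpleGraph V) (w : Sym2 V → Fin 2) (v : V) :
    vcColor G w v = ∑ y, if G.Adj v y then (w s(v, y) : ℕ) else 0 := by
  rw [← Finset.sum_filter, vcColor]
  symm
  refine Finset.sum_bij (fun y _ => s(v, y)) ?_ ?_ ?_ ?_
  · intro y hy
    simpa using hy
  · intro y _ z _ h
    exact Sym2.congr_right.mp h
  · intro e he
    induction e with
    | _ a b =>
      simp only [Set.Finite.mem_toFinset, SimpleGraph.incidenceSet, Set.mem_ofPred_eq,
        SimpleGraph.mem_edgeSet, Sym2.mem_iff] at he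
      obtain ⟨hab, rfl | rfl⟩ := he
      · exact ⟨b, by simpa using hab, rfl⟩
      · exact ⟨a, by simpa using hab.symm, Sym2.eq_swap⟩
  · intro y _
    rfl

theorem vcColor_congr [Finite V] {G G' : SimpleGraph V} {w w' : Sym2 V → Fin 2} {v : V}
    (hG : ∀ y, G.Adj v y ↔ G'.Adj v y) (hw : ∀ y, w s(v, y) = w' s(v, y)) :
    vcColor G w v = vcColor G' w' v := by
  classical
  have := Fintype.ofFinite V
  rw [vcColor_eq_sum, vcColor_eq_sum]
  exact Finset.sum_congr rfl fun y _ => if_congr (hG y) (by rw [hw]) rfl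

/-- If all neighbors of `v` lie in `S`, then the color of `v` is at most `|S|`. -/
theorem vcColor_le_ncard [Finite V] {G : SimpleGraph V} {S : Set V} (w : Sym2 V → Fin 2) {v : V}
    (h : ∀ y, G.Adj v y → y ∈ S) : vcColor G w v ≤ S.ncard := by
  classical
  have := Fintype.ofFinite V
  rw [vcColor_eq_sum, Set.ncard_eq_toFinset_card', Finset.card_eq_sum_ones,
    ← Finset.sum_filter]
  refine (Finset.sum_le_sum_of_subset (t := S.toFinset) fun y hy => ?_).trans
    (Finset.sum_le_sum fun y _ => by omega)
  simpa using h y (by simpa using hy)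

/-- If `v` is joined to all of `A` by edges of weight one, then its color is at least `|A|`. -/
theorem ncard_le_vcColor [Finite V] {G : SimpleGraph V} {A : Set V} {w : Sym2 V → Fin 2} {v : V}
    (h : ∀ a ∈ A, G.Adj v a ∧ w s(v, a) = 1) : A.ncard ≤ vcColor G w v := by
  classical
  have := Fintype.ofFinite V
  rw [vcColor_eq_sum, Set.ncard_eq_toFinset_card', Finset.card_eq_sum_ones]
  refine le_trans (Finset.sum_le_sum fun a ha => ?_)
    (Finset.sum_le_sum_of_subset (Finset.subset_univ A.toFinset))
  simp [h a (by simpa using ha)]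

/-- Reassigning the weights between `x` and a set `B` of its neighbors realizes any number
`m ≤ |B|` of additional ones at `x`, and affects only the colors of `x` and of `B`. -/
theorem exists_reweight [Finite V] (G : SimpleGraph V) (w : Sym2 V → Fin 2) (x : V)
    (B : Finset V) (hB : ∀ a ∈ B, G.Adj x a) :
    ∃ b : ℕ, ∀ m ≤ B.card, ∃ w' : Sym2 V → Fin 2, vcColor G w' x = b + m ∧
      (∀ v, v ≠ x → v ∉ B → vcColor G w' v = vcColor G w v) ∧
      ∀ e, (∀ a ∈ B, e ≠ s(x, a)) → w' e = w e := by
  classical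
  have := Fintype.ofFinite V
  refine ⟨∑ y ∈ Finset.univ \ B, if G.Adj x y then (w s(x, y) : ℕ) else 0, fun m hm => ?_⟩
  obtain ⟨M, hM, rfl⟩ := Finset.exists_subset_card_eq hm
  let w' : Sym2 V → Fin 2 := fun e =>
    if ∃ a ∈ B, e = s(x, a) then (if ∃ a ∈ M, e = s(x, a) then 1 else 0) else w e
  have hw' : ∀ e, (∀ a ∈ B, e ≠ s(x, a)) → w' e = w e := fun e he =>
    if_neg fun ⟨a, ha, h⟩ => he a ha h
  refine ⟨w', ?_, fun v hvx hvB => vcColor_congr (fun _ => Iff.rfl) fun y => hw' _ ?_, hw'⟩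
  · rw [vcColor_eq_sum, ← Finset.sum_sdiff (Finset.subset_univ B)]
    congr 1
    · refine Finset.sum_congr rfl fun y hy => ?_
      rw [hw' _ fun a ha h => ?_]
      have : y = a := Sym2.congr_right.mp h
      simp_all
    · rw [← Finset.inter_eq_right.mpr hM, Finset.card_eq_sum_ones, ← Finset.sum_ite_mem]
      refine Finset.sum_congr rfl fun a ha => ?_
      by_cases haM : a ∈ M <;>
        simp [w', hB a ha, ha, haM, Sym2.congr_right, -Sym2.eq, -Sym2.rel_iff']
  · rintro a ha h
    rcases Sym2.eq_iff.mp h with ⟨h, -⟩ | ⟨h, -⟩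
    · exact hvx h
    · exact hvB (h ▸ ha)

/-- The edges between `T` and a large set `B` outside the vertex cover `S` can be reweighted so
that all conflicts at `T` disappear: `T` is made proper one vertex at a time, by giving each
vertex a color that exceeds `|S|` and is not yet used on `S`. -/
theorem exists_vcProper_of_reweight [Finite V] (G : SimpleGraph V) (S : Set V)
    (hvc : IsVertexCover G S) (E₁ : Set (Sym2 V)) (A : Set V) (hAS : ∀ a ∈ A, a ∉ S)
    (B : Finset V) (hBA : ∀ a ∈ B, a ∈ A) (hcard : 2 * S.ncard + 1 ≤ B.card) (T : Finset V)
    (hTS : ∀ x ∈ T, x ∈ S) (hTB : ∀ x ∈ T, ∀ a ∈ B, G.Adj x a ∧ s(x, a) ∉ E₁)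
    (w : Sym2 V → Fin 2) (hw : ∀ e ∈ E₁, w e = 1)
    (hhigh : ∀ x ∉ T, ∀ a ∈ A, G.Adj x a → S.ncard < vcColor G w x)
    (hne : ∀ x ∉ T, ∀ y ∉ T, x ∉ A → y ∉ A → G.Adj x y → vcColor G w x ≠ vcColor G w y) :
    ∃ w' : Sym2 V → Fin 2, vcProper G w' ∧ ∀ e ∈ E₁, w' e = 1 := by
  classical
  have hlow : ∀ (w : Sym2 V → Fin 2) (v : V), v ∉ S → vcColor G w v ≤ S.ncard := fun w v hv =>
    vcColor_le_ncard w fun y hy => (hvc hy).resolve_left hv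
  induction T using Finset.induction_on generalizing w with
  | empty =>
    refine ⟨w, fun x y hxy => ?_, hw⟩
    by_cases hx : x ∈ A
    · exact ((hlow w x (hAS x hx)).trans_lt (hhigh y (by simp) x hx hxy.symm)).ne
    by_cases hy : y ∈ A
    · exact ((hlow w y (hAS y hy)).trans_lt (hhigh x (by simp) y hy hxy)).ne'
    exact hne x (by simp) y (by simp) hx hy hxy
  | insert x T hxT ih =>
    have hxS : x ∈ S := hTS x (by simp)
    have hxB := hTB x (by simp)
    obtain ⟨b, hb⟩ := exists_reweight G w x B fun a ha => (hxB a ha).1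
    obtain ⟨c, hc, hcS⟩ : ∃ c ∈ Finset.Icc (b + S.ncard + 1) (b + (2 * S.ncard + 1)),
        c ∉ S.toFinite.toFinset.image (vcColor G w) := by
      refine Finset.exists_mem_notMem_of_card_lt_card (Finset.card_image_le.trans_lt ?_)
      rw [← Set.ncard_eq_toFinset_card, Nat.card_Icc]
      omega
    rw [Finset.mem_Icc] at hc
    obtain ⟨w', hx, hv, he⟩ := hb (c - b) (by omega)
    have hxc : vcColor G w' x = c := by omega
    have hxne : ∀ y, y ∉ A → y ≠ x → vcColor G w' x ≠ vcColor G w' y := by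
      intro y hyA hyx
      by_cases hyS : y ∈ S
      · rw [hxc, hv y hyx fun h => hyA (hBA y h)]
        rintro rfl
        exact hcS (Finset.mem_image_of_mem _ (by simpa using hyS))
      · have := hlow w' y hyS
        omega
    refine ih (fun y hy => hTS y (by simp [hy])) (fun y hy => hTB y (by simp [hy])) w'
      (fun e heE => ?_) (fun y hy a ha hya => ?_) fun y hy z hz hyA hzA hyz => ?_
    · rw [he e fun a ha h => (hxB a ha).2 (h ▸ heE), hw e heE]
    · by_cases hyx : y = x
      · subst hyx
        omega
      · have hyS : y ∈ S := (hvc hya).resolve_right (hAS a ha)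
        rw [hv y hyx fun h => hAS y (hBA y h) hyS]
        exact hhigh y (by simp [hy, hyx]) a ha hya
    · by_cases hyx : y = x
      · exact hyx ▸ hxne z hzA (hyx ▸ hyz.ne')
      by_cases hzx : z = x
      · exact hzx ▸ (hxne y hyA hyx).symm
      rw [hv y hyx fun h => hyA (hBA y h), hv z hzx fun h => hzA (hBA z h)]
      exact hne y (by simp [hy, hyx]) z (by simp [hz, hzx]) hyA hzA hyz

/-- With `A` a class of at least `k(8k² + 8k) + 2` vertices outside the
vertex cover `S` sharing the open neighborhood `S₁ ⊆ S` and the pre-weighted neighbor set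
`S₂`, deleting from `G` all non-pre-weighted edges incident to a fixed `u ∈ A` preserves
the existence of a proper weighting extending the all-ones pre-weighting on `E₁`. -/
theorem stmt_13 [Finite V] (G : SimpleGraph V) (k : ℕ) (S : Set V)
    (hvc : IsVertexCover G S) (hS : S.ncard = k)
    (E₁ : Set (Sym2 V)) (hE₁ : E₁ ⊆ G.edgeSet)
    (A : Set V) (hAS : ∀ a ∈ A, a ∉ S)
    (S₁ : Set V) (hS₁ : S₁ ⊆ S) (hnb : ∀ a ∈ A, G.neighborSet a = S₁)
    (S₂ : Set V) (hS₂ : ∀ a ∈ A, {x ∈ S₁ | s(a, x) ∈ E₁} = S₂)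
    (hA : k * (8 * k ^ 2 + 8 * k) + 2 ≤ A.ncard)
    (u : V) (hu : u ∈ A) :
    (∃ w : Sym2 V → Fin 2, vcProper G w ∧ ∀ e ∈ E₁, w e = 1) ↔
      (∃ w : Sym2 V → Fin 2,
        vcProper (G.deleteEdges (G.incidenceSet u \ E₁)) w ∧ ∀ e ∈ E₁, w e = 1) := by
  classical
  set D := G.incidenceSet u \ E₁ with hD
  have hadj : ∀ a ∈ A, ∀ x, G.Adj a x ↔ x ∈ S₁ := fun a ha x => by
    rw [← hnb a ha, SimpleGraph.mem_neighborSet]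
  have hmem : ∀ a ∈ A, ∀ x ∈ S₁, (x ∈ S₂ ↔ s(x, a) ∈ E₁) := fun a ha x hx => by
    rw [← hS₂ a ha, Sym2.eq_swap]
    simp [hx]
  have hdel : ∀ x y, x ≠ u → y ≠ u → (G.Adj x y ↔ (G.deleteEdges D).Adj x y) := by
    intro x y hx hy
    simp [hD, SimpleGraph.incidenceSet, hx.symm, hy.symm]
  have hdelE : ∀ x y, s(x, y) ∈ E₁ → (G.deleteEdges D).Adj x y := by
    intro x y h
    simpa [hD, h] using hE₁ h
  have hle : G.deleteEdges D ≤ G := SimpleGraph.deleteEdges_le D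
  have hvc' : IsVertexCover (G.deleteEdges D) S := fun x y h => hvc (hle h)
  -- away from `u` and `S₁ \ S₂`, both graphs have the same edges
  have hcolor : ∀ (w : Sym2 V → Fin 2) (x : V), x ∉ S₁ \ S₂ → x ∉ A →
      vcColor G w x = vcColor (G.deleteEdges D) w x := by
    intro w x hxT hxA
    have hxu : x ≠ u := fun h => hxA (h ▸ hu)
    refine vcColor_congr (fun y => ?_) fun _ => rfl
    by_cases hy : y = u
    · subst hy
      refine ⟨fun h => hdelE _ _ ?_, fun h => hle h⟩
      have hx₁ : x ∈ S₁ := (hadj y hu x).mp h.symm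
      exact (hmem y hu x hx₁).mp (by_contra fun h₂ => hxT ⟨hx₁, h₂⟩)
    · exact hdel x y hxu hy
  have hbound : S.ncard < A.ncard ∧ 2 * S.ncard + 1 ≤ (A.toFinite.toFinset.erase u).card := by
    rw [Finset.card_erase_of_mem (by simpa using hu), ← Set.ncard_eq_toFinset_card, hS]
    have : 2 * k ≤ k * (8 * k ^ 2 + 8 * k) := by nlinarith [Nat.le_self_pow two_ne_zero k]
    omega
  have main : ∀ G' : SimpleGraph V, G' ≤ G → G.deleteEdges D ≤ G' →
      ∀ w : Sym2 V → Fin 2, (∀ e ∈ E₁, w e = 1) →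
      (∀ x ∉ S₁ \ S₂, ∀ y ∉ S₁ \ S₂, x ∉ A → y ∉ A → G'.Adj x y →
        vcColor G' w x ≠ vcColor G' w y) →
      ∃ w' : Sym2 V → Fin 2, vcProper G' w' ∧ ∀ e ∈ E₁, w' e = 1 := by
    intro G' hG' hG'' w hw hne
    refine exists_vcProper_of_reweight G' S (fun x y h => hvc (hG' h)) E₁ A hAS
      (A.toFinite.toFinset.erase u) (by simp) hbound.2 (S₁ \ S₂).toFinite.toFinset ?_ ?_ w hw ?_
      (by simpa using hne)
    · intro x hx
      exact hS₁ (by simp_all)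
    · intro x hx a ha
      simp only [Finset.mem_erase, Set.Finite.mem_toFinset, Set.mem_sdiff] at hx ha
      have hxu : x ≠ u := fun h => hAS u hu (h ▸ hS₁ hx.1)
      exact ⟨hG'' ((hdel x a hxu ha.1).mp ((hadj a ha.2 x).mpr hx.1).symm),
        fun h => hx.2 ((hmem a ha.2 x hx.1).mpr h)⟩
    · intro x hx a ha hxa
      have hx₁ : x ∈ S₁ := (hadj a ha x).mp (hG' hxa).symm
      have hx₂ : x ∈ S₂ := by_contra fun h => hx (by simp [hx₁, h])
      refine hbound.1.trans_le (ncard_le_vcColor fun b hb => ?_)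
      have := (hmem b hb x hx₁).mp hx₂
      exact ⟨hG'' (hdelE x b this), hw _ this⟩
  constructor
  · rintro ⟨w, hp, hw⟩
    refine main _ hle le_rfl w hw fun x hx y hy hxA hyA hxy => ?_
    rw [← hcolor w x hx hxA, ← hcolor w y hy hyA]
    exact hp x y (hle hxy)
  · rintro ⟨w, hp, hw⟩
    refine main G le_rfl hle w hw fun x hx y hy hxA hyA hxy => ?_
    rw [hcolor w x hx hxA, hcolor w y hy hyA]
    exact hp x y ((hdel x y (fun h => hxA (h ▸ hu)) fun h => hyA (h ▸ hu)).mp hxy)
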